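/- Let A be a separable C*-algebra, h(z) = Π_{j=1}^n (i − z_j)^{-1} for z ∈ ℝ^n, and for u in the A-valued Schwartz space define f(x,ξ) = (2π)^{−n/2} ∫ e^{−i y·ξ} h(y − x) u(y) dy. Then ∫∫ f(x,ξ)* f(x,ξ) dx dξ = (∫ |h(x)|² dx) · ∫ u(y)* u(y) dy, and consequently ‖f‖₂ ≤ c₃ ‖u‖₂ with c₃ = ‖h‖_{L²(ℝ^n)}, a constant independent of u. -/

import Mathlib

open MeasureTheory
open scoped BigOperators
open scoped FourierTransform ContDiff SchwartzMap Nat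

section Resolvent

lemma one_le_norm_I_add_sub (a t : ℝ) : 1 ≤ ‖Complex.I + (a : ℂ) - (t : ℂ)‖ := by
  simpa using Complex.abs_im_le_norm (Complex.I + (a : ℂ) - (t : ℂ))

lemma I_add_sub_ne_zero (a t : ℝ) : Complex.I + (a : ℂ) - (t : ℂ) ≠ 0 :=
  norm_pos_iff.1 (one_pos.trans_le (one_le_norm_I_add_sub a t))

lemma contDiff_I_add_sub_inv (a : ℝ) :
    ContDiff ℝ ∞ fun t : ℝ ↦ (Complex.I + (a : ℂ) - (t : ℂ))⁻¹ :=
  (contDiff_const.sub Complex.ofRealCLM.contDiff).inv (I_add_sub_ne_zero a)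

lemma iteratedDeriv_I_add_sub_inv (a : ℝ) (m : ℕ) :
    iteratedDeriv m (fun t : ℝ ↦ (Complex.I + (a : ℂ) - (t : ℂ))⁻¹) =
      fun t : ℝ ↦ (m ! : ℂ) * (Complex.I + (a : ℂ) - (t : ℂ))⁻¹ ^ (m + 1) := by
  induction m with
  | zero => simp
  | succ m ih =>
    rw [iteratedDeriv_succ, ih]
    funext t
    have h₀ := I_add_sub_ne_zero a t
    have h₁ : HasDerivAt (fun t : ℝ ↦ Complex.I + (a : ℂ) - (t : ℂ)) (-1) t := by
      simpa using (HasDerivAt.ofReal_comp (hasDerivAt_id t)).const_sub (Complex.I + (a : ℂ))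
    rw [(((h₁.fun_inv h₀).fun_pow (m + 1)).const_mul (m ! : ℂ)).deriv, Nat.factorial_succ]
    simp only [add_tsub_cancel_right, pow_succ, neg_neg]
    push_cast
    field_simp

/-- The weight `t ↦ (i + a) / (i + a - t)` has at most linear growth, together with all its
derivatives, uniformly in `a`. -/
lemma norm_iteratedFDeriv_resolvent_le (a : ℝ) (m : ℕ) (t : ℝ) :
    ‖iteratedFDeriv ℝ m
      (fun t : ℝ ↦ (Complex.I + (a : ℂ)) * (Complex.I + (a : ℂ) - (t : ℂ))⁻¹) t‖ ≤
      m ! * (1 + |t|) := by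
  have h₁ := one_le_norm_I_add_sub a t
  have h₂ : ‖(Complex.I + (a : ℂ) - (t : ℂ))⁻¹‖ ≤ 1 := by
    rw [norm_inv]; exact inv_le_one_of_one_le₀ h₁
  have h₃ : ‖(Complex.I + (a : ℂ)) * (Complex.I + (a : ℂ) - (t : ℂ))⁻¹‖ ≤ 1 + |t| := by
    have : (Complex.I + (a : ℂ)) * (Complex.I + (a : ℂ) - (t : ℂ))⁻¹ =
        1 + t * (Complex.I + (a : ℂ) - (t : ℂ))⁻¹ := by
      have := I_add_sub_ne_zero a t
      field_simp
      ring
    rw [this]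
    refine (norm_add_le _ _).trans ?_
    rw [norm_mul, norm_one, Complex.norm_real, Real.norm_eq_abs]
    gcongr
    exact mul_le_of_le_one_right (abs_nonneg t) h₂
  rw [norm_iteratedFDeriv_eq_norm_iteratedDeriv, iteratedDeriv_const_mul_field,
    iteratedDeriv_I_add_sub_inv]
  calc _ = m ! * (‖(Complex.I + (a : ℂ)) * (Complex.I + (a : ℂ) - (t : ℂ))⁻¹‖ *
        ‖(Complex.I + (a : ℂ) - (t : ℂ))⁻¹‖ ^ m) := by
        simp only [norm_mul, norm_pow, Complex.norm_natCast, pow_succ]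
        ring
    _ ≤ m ! * ((1 + |t|) * 1) := by
        gcongr
        exact pow_le_one₀ (norm_nonneg _) h₂
    _ = _ := by ring

end Resolvent

section UniformlySchwartz

variable {ι V A : Type*} [NormedAddCommGroup V] [InnerProductSpace ℝ V]
  [NormedAddCommGroup A] [NormedSpace ℂ A]

/-- A family of smooth functions which satisfies the Schwartz bounds uniformly. -/
def UniformlySchwartz (g : ι → V → A) : Prop :=
  (∀ i, ContDiff ℝ ∞ (g i)) ∧
    ∀ k m : ℕ, ∃ C : ℝ, ∀ i y, ‖y‖ ^ k * ‖iteratedFDeriv ℝ m (g i) y‖ ≤ C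

lemma UniformlySchwartz.smul {g : ι → V → A} (hg : UniformlySchwartz g) {w : ι → V → ℂ}
    (hw : ∀ i, ContDiff ℝ ∞ (w i))
    (hw_le : ∀ i m y, ‖iteratedFDeriv ℝ m (w i) y‖ ≤ m ! * (1 + ‖y‖)) :
    UniformlySchwartz fun i y ↦ w i y • g i y := by
  refine ⟨fun i ↦ (hw i).smul (hg.1 i), fun k m ↦ ?_⟩
  choose C hC using hg.2
  refine ⟨∑ j ∈ Finset.range (m + 1), (m.choose j : ℝ) * (j ! : ℝ) *
    (C k (m - j) + C (k + 1) (m - j)), fun i y ↦ ?_⟩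
  calc ‖y‖ ^ k * ‖iteratedFDeriv ℝ m (fun y ↦ w i y • g i y) y‖
      ≤ ‖y‖ ^ k * ∑ j ∈ Finset.range (m + 1), (m.choose j : ℝ) *
        ‖iteratedFDeriv ℝ j (w i) y‖ * ‖iteratedFDeriv ℝ (m - j) (g i) y‖ := by
        gcongr
        exact norm_iteratedFDeriv_smul_le (hw i) (hg.1 i) y (by exact_mod_cast le_top)
    _ ≤ ‖y‖ ^ k * ∑ j ∈ Finset.range (m + 1), (m.choose j : ℝ) *
        (j ! * (1 + ‖y‖)) * ‖iteratedFDeriv ℝ (m - j) (g i) y‖ := by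
        gcongr with j
        exact hw_le i j y
    _ = ∑ j ∈ Finset.range (m + 1), (m.choose j : ℝ) * (j ! : ℝ) *
        (‖y‖ ^ k * ‖iteratedFDeriv ℝ (m - j) (g i) y‖ +
          ‖y‖ ^ (k + 1) * ‖iteratedFDeriv ℝ (m - j) (g i) y‖) := by
        rw [Finset.mul_sum]
        refine Finset.sum_congr rfl fun j _ ↦ ?_
        ring
    _ ≤ _ := by
        gcongr with j
        · exact hC _ _ i y
        · exact hC _ _ i y

/-- The Fourier transforms of a uniformly Schwartz family decay uniformly. -/
lemma UniformlySchwartz.fourier_le [FiniteDimensional ℝ V] [MeasurableSpace V] [BorelSpace V]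
    {g : ι → V → A} (hg : UniformlySchwartz g) (k : ℕ) :
    ∃ C : ℝ, ∀ i ξ, (1 + ‖ξ‖) ^ k * ‖𝓕 (g i) ξ‖ ≤ C := by
  let G : ι → 𝓢(V, A) := fun i ↦
    ⟨g i, hg.1 i, fun k m ↦ (hg.2 k m).imp fun C hC y ↦ hC i y⟩
  have hG : Bornology.IsVonNBounded ℂ (Set.range G) := by
    rw [(schwartz_withSeminorms ℂ V A).isVonNBounded_iff_seminorm_bddAbove]
    rintro ⟨k, m⟩
    obtain ⟨C, hC⟩ := hg.2 k m
    refine ⟨max C 0, ?_⟩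
    rintro _ ⟨_, ⟨i, rfl⟩, rfl⟩
    exact SchwartzMap.seminorm_le_bound ℂ k m (G i) (le_max_right _ _)
      fun y ↦ (hC i y).trans (le_max_left _ _)
  have hF := hG.image (FourierTransform.fourierCLM ℂ 𝓢(V, A))
  rw [(schwartz_withSeminorms ℂ V A).isVonNBounded_iff_seminorm_bddAbove] at hF
  choose C hC using fun l : ℕ ↦ hF (l, 0)
  refine ⟨∑ l ∈ Finset.range (k + 1), (k.choose l : ℝ) * C l, fun i ξ ↦ ?_⟩
  rw [add_comm (1 : ℝ), add_pow, Finset.sum_mul]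
  refine Finset.sum_le_sum fun l _ ↦ ?_
  have h₁ := SchwartzMap.le_seminorm ℂ l 0 (𝓕 (G i)) ξ
  have h₂ := hC l ⟨_, ⟨_, ⟨i, rfl⟩, rfl⟩, rfl⟩
  rw [norm_iteratedFDeriv_zero] at h₁
  calc _ = (k.choose l : ℝ) * (‖ξ‖ ^ l * ‖𝓕 (g i) ξ‖) := by rw [one_pow]; ring
    _ ≤ _ := by
      gcongr
      exact h₁.trans h₂

end UniformlySchwartz

lemma uniformlySchwartz_resolvent_smul {n : ℕ} {A : Type*} [NormedAddCommGroup A]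
    [NormedSpace ℂ A] (u : 𝓢(EuclideanSpace ℝ (Fin n), A)) (s : Finset (Fin n)) :
    UniformlySchwartz fun (x : Fin n → ℝ) (y : EuclideanSpace ℝ (Fin n)) ↦
      (∏ j ∈ s, (Complex.I + (x j : ℂ)) * (Complex.I + (x j : ℂ) - (y j : ℂ))⁻¹) • u y := by
  classical
  induction s using Finset.induction_on with
  | empty =>
    simp only [Finset.prod_empty, one_smul]
    exact ⟨fun _ ↦ u.smooth', fun k m ↦ (u.decay' k m).imp fun C hC _ y ↦ hC y⟩
  | insert j s hj ih =>
    simp only [Finset.prod_insert hj, mul_smul _ (∏ _ ∈ _, _)]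
    have hw (a : ℝ) : ContDiff ℝ ∞ fun t : ℝ ↦
        (Complex.I + (a : ℂ)) * (Complex.I + (a : ℂ) - (t : ℂ))⁻¹ :=
      contDiff_const.mul (contDiff_I_add_sub_inv a)
    let L : EuclideanSpace ℝ (Fin n) →L[ℝ] ℝ := EuclideanSpace.proj j
    have hL (y) : ‖L y‖ ≤ ‖y‖ := PiLp.norm_apply_le y j
    have hL' : ‖L‖ ≤ 1 := L.opNorm_le_bound zero_le_one (by simpa using hL)
    refine ih.smul (w := fun x y ↦ (Complex.I + (x j : ℂ)) *
      (Complex.I + (x j : ℂ) - (y j : ℂ))⁻¹) (fun x ↦ (hw (x j)).comp L.contDiff)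
      fun x m y ↦ ?_
    have := L.iteratedFDeriv_comp_right (hw (x j)) y (i := m) (by exact_mod_cast le_top)
    change ‖iteratedFDeriv ℝ m ((fun t : ℝ ↦
        (Complex.I + (x j : ℂ)) * (Complex.I + (x j : ℂ) - (t : ℂ))⁻¹) ∘ L) y‖ ≤ _
    rw [this]
    refine (ContinuousMultilinearMap.norm_compContinuousLinearMap_le _ _).trans ?_
    calc _ ≤ (m ! * (1 + |L y|)) * ∏ _ : Fin m, (1 : ℝ) := by
          gcongr
          exact norm_iteratedFDeriv_resolvent_le _ _ _
      _ ≤ _ := by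
          rw [Finset.prod_const_one, mul_one]
          gcongr
          exact hL y

/-- Plancherel's formula for Schwartz functions with values in a star algebra. -/
lemma SchwartzMap.integral_star_fourier_mul_fourier {V A : Type*} [NormedAddCommGroup V]
    [InnerProductSpace ℝ V] [FiniteDimensional ℝ V] [MeasurableSpace V] [BorelSpace V]
    [NormedRing A] [StarRing A] [CStarRing A] [NormedAlgebra ℂ A] [StarModule ℂ A]
    [CompleteSpace A] (g : 𝓢(V, A)) :
    ∫ ξ, star (𝓕 (g : V → A) ξ) * 𝓕 (g : V → A) ξ = ∫ y, star (g y) * g y :=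
  SchwartzMap.integral_sesq_fourier_fourier g g
    ((ContinuousLinearMap.mul ℂ A).comp (starL ℂ : A ≃L⋆[ℂ] A).toContinuousLinearMap)

lemma norm_sq_prod_I_sub_inv {n : ℕ} (z : Fin n → ℝ) :
    ‖∏ j, (Complex.I - (z j : ℂ))⁻¹‖ ^ 2 = ∏ j, (1 + z j ^ 2)⁻¹ := by
  rw [norm_prod, ← Finset.prod_pow]
  refine Finset.prod_congr rfl fun j _ ↦ ?_
  rw [norm_inv, inv_pow, ← Complex.normSq_eq_norm_sq]
  simp [Complex.normSq_apply]
  ring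

lemma integrable_prod_inv_one_add_sq (n : ℕ) :
    Integrable fun z : Fin n → ℝ ↦ ∏ j, (1 + z j ^ 2)⁻¹ :=
  Integrable.fintype_prod fun _ ↦ integrable_inv_one_add_sq

lemma continuous_prod_I_sub_inv (n : ℕ) :
    Continuous fun z : Fin n → ℝ ↦ ∏ j, (Complex.I - (z j : ℂ))⁻¹ := by
  refine continuous_finsetProd _ fun j _ ↦ Continuous.inv₀ (by fun_prop) fun z ↦ ?_
  simpa using I_add_sub_ne_zero 0 (z j)

/-- For `h(z) = Π_j (i - z_j)⁻¹` and `f(x,ξ) = (2π)^{-n/2} ∫ e^{-iyξ} h(y-x) u(y) dy`,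
one has `∫∫ f* f = (∫ |h|²) ∫ u* u`, hence `‖f‖₂ ≤ ‖h‖_{L²} ‖u‖₂`. -/
theorem stmt15 {n : ℕ} {A : Type*} [NormedRing A] [StarRing A] [CStarRing A]
    [NormedAlgebra ℂ A] [StarModule ℂ A] [CompleteSpace A]
    [TopologicalSpace.SeparableSpace A]
    (u : SchwartzMap (Fin n → ℝ) A)
    (h : (Fin n → ℝ) → ℂ) (hh : ∀ z, h z = ∏ j, (Complex.I - (z j : ℂ))⁻¹)
    (f : (Fin n → ℝ) × (Fin n → ℝ) → A)
    (hf : ∀ x ξ : Fin n → ℝ,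
      f (x, ξ) = ((2 * Real.pi) ^ (-(n : ℝ) / 2) : ℝ) •
        ∫ y : Fin n → ℝ,
          (Complex.exp (-Complex.I * ((∑ j, y j * ξ j : ℝ) : ℂ)) * h (y - x)) • u y) :
    (∫ p : (Fin n → ℝ) × (Fin n → ℝ), star (f p) * f p)
        = (∫ x : Fin n → ℝ, ‖h x‖ ^ 2) • (∫ y : Fin n → ℝ, star (u y) * u y) ∧
    Real.sqrt ‖∫ p : (Fin n → ℝ) × (Fin n → ℝ), star (f p) * f p‖
        ≤ Real.sqrt (∫ x : Fin n → ℝ, ‖h x‖ ^ 2) *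
            Real.sqrt ‖∫ y : Fin n → ℝ, star (u y) * u y‖ := by
  obtain rfl : h = fun z ↦ ∏ j, (Complex.I - (z j : ℂ))⁻¹ := funext hh
  clear hh
  set h : (Fin n → ℝ) → ℂ := fun z ↦ ∏ j, (Complex.I - (z j : ℂ))⁻¹ with hh
  set c : ℝ := (2 * Real.pi) ^ (-(n : ℝ) / 2) with hc
  have hπ : 0 < 2 * Real.pi := by positivity
  have hc_sq : c * c * (2 * Real.pi) ^ n = 1 := by
    rw [hc, ← Real.rpow_natCast, ← Real.rpow_add hπ, ← Real.rpow_add hπ]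
    ring_nf
    simp
  have hh_cont : Continuous h := continuous_prod_I_sub_inv n
  have hh_sq (z) : ‖h z‖ ^ 2 = ∏ j, (1 + z j ^ 2)⁻¹ := norm_sq_prod_I_sub_inv z
  have hh_int : Integrable fun z ↦ ‖h z‖ ^ 2 := by
    simpa only [hh_sq] using integrable_prod_inv_one_add_sq n
  have hh_neg (z) : ‖h (-z)‖ ^ 2 = ‖h z‖ ^ 2 := by simp [hh_sq]
  -- Transfer to the Euclidean space, on which the Fourier transform is defined.
  let e : (Fin n → ℝ) → EuclideanSpace ℝ (Fin n) := WithLp.toLp 2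
  have he : MeasurePreserving e := PiLp.volume_preserving_toLp (Fin n)
  have he' : MeasurableEmbedding e := (MeasurableEquiv.toLp 2 (Fin n → ℝ)).measurableEmbedding
  let v : 𝓢(EuclideanSpace ℝ (Fin n), A) :=
    SchwartzMap.compCLMOfContinuousLinearEquiv ℂ (EuclideanSpace.equiv (Fin n) ℝ) u
  have hP := uniformlySchwartz_resolvent_smul v Finset.univ
  set P : (Fin n → ℝ) → EuclideanSpace ℝ (Fin n) → A := fun x y ↦
    (∏ j, (Complex.I + (x j : ℂ)) * (Complex.I + (x j : ℂ) - (y j : ℂ))⁻¹) • v y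
  let G (x : Fin n → ℝ) : 𝓢(EuclideanSpace ℝ (Fin n), A) :=
    h (-x) • ⟨P x, hP.1 x, fun k m ↦ (hP.2 k m).imp fun C hC y ↦ hC x y⟩
  have hG (x y) : G x (e y) = h (y - x) • u y := by
    change h (-x) • ((∏ j, (Complex.I + (x j : ℂ)) * (Complex.I + (x j : ℂ) - (y j : ℂ))⁻¹) •
      u y) = _
    rw [smul_smul, hh, ← Finset.prod_mul_distrib]
    congr 1
    refine Finset.prod_congr rfl fun j _ ↦ ?_
    have h₁ := I_add_sub_ne_zero (x j) 0
    simp only [Complex.ofReal_zero, sub_zero] at h₁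
    simp only [Pi.neg_apply, Pi.sub_apply, Complex.ofReal_neg, Complex.ofReal_sub,
      sub_neg_eq_add, inv_mul_cancel_left₀ h₁]
    congr 1
    ring
  have hfG (x ξ) : f (x, ξ) = c • 𝓕 (G x : EuclideanSpace ℝ (Fin n) → A)
      (e ((2 * Real.pi)⁻¹ • ξ)) := by
    rw [hf, Real.fourier_eq', ← he.integral_comp he']
    congr 2
    funext y
    rw [hG, mul_smul]
    congr 2
    have : inner ℝ (e y) (e ((2 * Real.pi)⁻¹ • ξ)) = (2 * Real.pi)⁻¹ * ∑ j, y j * ξ j := by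
      simp [e, PiLp.inner_apply, Finset.mul_sum]
      refine Finset.sum_congr rfl fun j _ ↦ ?_
      ring
    rw [this]
    have : -2 * Real.pi * ((2 * Real.pi)⁻¹ * ∑ j, y j * ξ j) = - ∑ j, y j * ξ j := by
      field_simp
    rw [this]
    push_cast
    ring
  obtain ⟨C, hC⟩ := hP.fourier_le (n + 1)
  have hFG (x : Fin n → ℝ) (w) : 𝓕 (G x : EuclideanSpace ℝ (Fin n) → A) w =
      h (-x) • 𝓕 (P x) w := by
    rw [Real.fourier_eq, Real.fourier_eq, ← integral_smul]
    refine integral_congr_ae (.of_forall fun y ↦ ?_)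
    exact smul_comm _ _ _
  have hf_le (x ξ) : ‖f (x, ξ)‖ ^ 2 ≤ ‖h x‖ ^ 2 *
      ((|c| * C) ^ 2 * (1 + ‖e ((2 * Real.pi)⁻¹ • ξ)‖) ^ (-(2 * (n + 1) : ℝ))) := by
    set w := e ((2 * Real.pi)⁻¹ • ξ)
    have hw : 0 < 1 + ‖w‖ := by positivity
    have h₁ : ‖𝓕 (P x) w‖ ≤ C * ((1 + ‖w‖) ^ (n + 1))⁻¹ := by
      rw [← div_eq_mul_inv, le_div_iff₀' (by positivity)]
      exact hC x w
    have h₂ : (1 + ‖w‖) ^ (-(2 * (n + 1) : ℝ)) = (((1 + ‖w‖) ^ (n + 1))⁻¹) ^ 2 := by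
      rw [Real.rpow_neg hw.le, inv_pow, ← pow_mul, ← Real.rpow_natCast]
      push_cast
      ring_nf
    rw [h₂, hfG, hFG, norm_smul, norm_smul, Real.norm_eq_abs, mul_pow, mul_pow, hh_neg]
    calc _ ≤ |c| ^ 2 * (‖h x‖ ^ 2 * (C * ((1 + ‖w‖) ^ (n + 1))⁻¹) ^ 2) := by gcongr
      _ = _ := by ring
  have hb_int : Integrable fun ξ : Fin n → ℝ ↦
      (|c| * C) ^ 2 * (1 + ‖e ((2 * Real.pi)⁻¹ • ξ)‖) ^ (-(2 * (n + 1) : ℝ)) := by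
    refine Integrable.const_mul ?_ _
    have h₁ : Integrable fun w : EuclideanSpace ℝ (Fin n) ↦
        (1 + ‖w‖) ^ (-(2 * (n + 1) : ℝ)) := by
      refine integrable_one_add_norm ?_
      rw [finrank_euclideanSpace_fin]
      linarith [(Nat.cast_nonneg n : (0 : ℝ) ≤ n)]
    exact ((he.integrable_comp_emb he').2 h₁).comp_smul (inv_ne_zero hπ.ne')
  have hf_meas : StronglyMeasurable f := by
    have : f = fun p : (Fin n → ℝ) × (Fin n → ℝ) ↦ c • ∫ y : Fin n → ℝ,
        (Complex.exp (-Complex.I * ((∑ j, y j * p.2 j : ℝ) : ℂ)) * h (y - p.1)) • u y :=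
      funext fun p ↦ hf p.1 p.2
    rw [this]
    refine StronglyMeasurable.const_smul (StronglyMeasurable.integral_prod_right
      (f := fun (p : (Fin n → ℝ) × (Fin n → ℝ)) (y : Fin n → ℝ) ↦
        (Complex.exp (-Complex.I * ((∑ j, y j * p.2 j : ℝ) : ℂ)) * h (y - p.1)) • u y) ?_) c
    refine Continuous.stronglyMeasurable ?_
    have := u.continuous
    simp only [Function.uncurry_def]
    fun_prop
  have hf_int : Integrable fun p ↦ star (f p) * f p := by
    refine Integrable.mono' (hh_int.mul_prod hb_int)
      (hf_meas.star.mul hf_meas).aestronglyMeasurable (.of_forall fun p ↦ ?_)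
    rw [CStarRing.norm_star_mul_self, ← sq]
    exact hf_le p.1 p.2
  have hu_int : Integrable fun y ↦ star (u y) * u y := by
    obtain ⟨M, hM⟩ : ∃ M, ∀ y, ‖star (u y)‖ ≤ M :=
      ⟨SchwartzMap.seminorm ℝ 0 0 u, fun y ↦ by
        simpa using SchwartzMap.norm_le_seminorm ℝ u y⟩
    exact u.integrable.bdd_mul (c := M) (u.continuous.star).aestronglyMeasurable (.of_forall hM)
  have h_plancherel (x) : ∫ ξ, star (f (x, ξ)) * f (x, ξ) =
      ∫ y, ‖h (y - x)‖ ^ 2 • (star (u y) * u y) := by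
    set Φ : EuclideanSpace ℝ (Fin n) → A := fun w ↦
      star (𝓕 (G x : EuclideanSpace ℝ (Fin n) → A) w) *
        𝓕 (G x : EuclideanSpace ℝ (Fin n) → A) w with hΦ
    calc ∫ ξ, star (f (x, ξ)) * f (x, ξ)
        = ∫ ξ : Fin n → ℝ, (c * c) • Φ (e ((2 * Real.pi)⁻¹ • ξ)) := by
          simp only [hfG, hΦ, star_smul, star_trivial, smul_mul_smul_comm]
      _ = ∫ w, Φ w := by
          rw [integral_smul, Measure.integral_comp_smul volume (fun ξ ↦ Φ (e ξ)),
            he.integral_comp he', smul_smul, Module.finrank_fin_fun, inv_pow, inv_inv,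
            abs_of_pos (by positivity), hc_sq, one_smul]
      _ = ∫ y, star (G x y) * G x y := (G x).integral_star_fourier_mul_fourier
      _ = ∫ y, ‖h (y - x)‖ ^ 2 • (star (u y) * u y) := by
          rw [← he.integral_comp he']
          refine integral_congr_ae (.of_forall fun y ↦ ?_)
          simp only [hG, star_smul, smul_mul_smul_comm]
          rw [← Complex.coe_smul, Complex.star_def, Complex.conj_mul', Complex.ofReal_pow]
  have h_eq : ∫ p : (Fin n → ℝ) × (Fin n → ℝ), star (f p) * f p =
      (∫ x, ‖h x‖ ^ 2) • ∫ y, star (u y) * u y := by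
    rw [Measure.volume_eq_prod, integral_prod _ hf_int]
    simp only [h_plancherel]
    refine Eq.trans (integral_congr_ae (.of_forall fun x ↦ ?_)) (integral_convolution
      (μ := volume) (ContinuousLinearMap.lsmul ℝ ℝ).flip hu_int hh_int)
    refine integral_congr_ae (.of_forall fun y ↦ ?_)
    change _ = ‖h (x - y)‖ ^ 2 • (star (u y) * u y)
    rw [← hh_neg (x - y), neg_sub]
  refine ⟨h_eq, ?_⟩
  rw [h_eq, norm_smul, Real.norm_of_nonneg (integral_nonneg fun x ↦ by positivity),
    Real.sqrt_mul (integral_nonneg fun x ↦ by positivity)]
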